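/- Let n ≥ 1 and n+8 ≤ d ≤ D. Let 𝒟 = 𝒟₁ × ⋯ × 𝒟_D be a product distribution on ℝ^D in which 𝒟_k = N(0,1) for k = 1,…,n+8 and each 𝒟_k for k > n+8 is either a Gaussian N(0, σ_k²) or a trimodal Gaussian mixture N^mix_{σ_k, μ_k}. Let the n rows of A ∈ ℝ^{n×d} and the vector x ∈ ℝ^d be i.i.d. samples from the marginal 𝒟₁ × ⋯ × 𝒟_d. Then all four of the following expectations are finite: E‖(A⁺)ᵀx‖², E[λ_max((AAᵀ)⁻¹)²], E[λ_max((AAᵀ)⁻¹)‖(A⁺)ᵀx‖²], and E[λ_max((AAᵀ)⁻¹)²‖(A⁺)ᵀx‖²]. -/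

import Mathlib

open MeasureTheory ProbabilityTheory Matrix
open scoped NNReal ENNReal

noncomputable section

/-- Squared Euclidean norm of a vector in `ℝ^n`. -/
def sqnorm {n : ℕ} (v : Fin n → ℝ) : ℝ := ∑ i, v i ^ 2

/-- Moore–Penrose pseudoinverse of a matrix with linearly independent rows:
`M⁺ = Mᵀ (M Mᵀ)⁻¹`. -/
def pinvRows {m n : ℕ} (M : Matrix (Fin m) (Fin n) ℝ) : Matrix (Fin n) (Fin m) ℝ :=
  Mᵀ * (M * Mᵀ)⁻¹

/-- The largest eigenvalue of a (symmetric positive definite) matrix, as the supremum of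
its set of eigenvalues. -/
def lambdaMax {n : ℕ} (M : Matrix (Fin n) (Fin n) ℝ) : ℝ :=
  sSup {t : ℝ | ∃ v : Fin n → ℝ, v ≠ 0 ∧ M *ᵥ v = t • v}

/-- Trimodal Gaussian mixture `N^mix_{σ,μ} = (1/3)N(0,σ²) + (1/3)N(-μ,σ²) + (1/3)N(μ,σ²)`. -/
def gmix (σ μ : ℝ) : Measure ℝ :=
  (3 : ℝ≥0∞)⁻¹ • gaussianReal 0 (σ ^ 2).toNNReal
    + (3 : ℝ≥0∞)⁻¹ • gaussianReal (-μ) (σ ^ 2).toNNReal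
    + (3 : ℝ≥0∞)⁻¹ • gaussianReal μ (σ ^ 2).toNNReal

instance (σ μ : ℝ) : IsProbabilityMeasure (gmix σ μ) := by
  constructor
  simp only [gmix, Measure.coe_add, Pi.add_apply, Measure.smul_apply, smul_eq_mul,
    measure_univ, mul_one]
  rw [show ((3 : ℝ≥0∞)⁻¹ + 3⁻¹ + 3⁻¹ : ℝ≥0∞) = 3 * 3⁻¹ by ring]
  exact ENNReal.mul_inv_cancel (by norm_num) (by norm_num)

lemma sqnorm_nonneg {n : ℕ} (v : Fin n → ℝ) : 0 ≤ sqnorm v :=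
  Finset.sum_nonneg fun _ _ => sq_nonneg _

lemma sqnorm_eq_dotProduct {n : ℕ} (v : Fin n → ℝ) : sqnorm v = v ⬝ᵥ v := by
  simp [sqnorm, dotProduct, sq]

lemma sqnorm_pos {n : ℕ} {v : Fin n → ℝ} (hv : v ≠ 0) : 0 < sqnorm v := by
  refine (sqnorm_nonneg v).lt_of_ne' fun h => hv ?_
  rwa [sqnorm_eq_dotProduct, dotProduct_self_eq_zero] at h

section Deterministic

variable {n d : ℕ} {A : Matrix (Fin n) (Fin d) ℝ} {T : ℝ}

lemma sqnorm_transpose_mulVec (A : Matrix (Fin n) (Fin d) ℝ) (v : Fin n → ℝ) :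
    sqnorm (Aᵀ *ᵥ v) = v ⬝ᵥ ((A * Aᵀ) *ᵥ v) := by
  rw [sqnorm_eq_dotProduct, ← mulVec_mulVec, dotProduct_mulVec v, ← mulVec_transpose]

lemma isUnit_det_of_sqnorm_le (h : ∀ v, sqnorm v ≤ T * sqnorm (Aᵀ *ᵥ v)) :
    IsUnit (A * Aᵀ).det := by
  rw [isUnit_iff_ne_zero]
  intro hdet
  obtain ⟨v, hv, hv0⟩ := Matrix.exists_mulVec_eq_zero_iff.2 hdet
  have := h v
  rw [sqnorm_transpose_mulVec, hv0, dotProduct_zero, mul_zero] at this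
  exact (sqnorm_pos hv).not_ge this

/-- If `‖v‖² ≤ T ‖Aᵀ v‖²` for all `v`, the eigenvalues of `(A Aᵀ)⁻¹` lie in `[0, T]`. -/
lemma lambdaMax_nonneg_and_le (hT : 0 ≤ T) (h : ∀ v, sqnorm v ≤ T * sqnorm (Aᵀ *ᵥ v)) :
    0 ≤ lambdaMax (A * Aᵀ)⁻¹ ∧ lambdaMax (A * Aᵀ)⁻¹ ≤ T := by
  have hu := isUnit_det_of_sqnorm_le h
  have key : ∀ t ∈ {t : ℝ | ∃ v : Fin n → ℝ, v ≠ 0 ∧ (A * Aᵀ)⁻¹ *ᵥ v = t • v},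
      0 ≤ t ∧ t ≤ T := by
    rintro t ⟨v, hv, hvt⟩
    have h1 : v = t • ((A * Aᵀ) *ᵥ v) := by
      rw [← mulVec_smul, ← hvt, mulVec_mulVec, mul_nonsing_inv _ hu, one_mulVec]
    have h2 : sqnorm v = t * sqnorm (Aᵀ *ᵥ v) := by
      rw [sqnorm_transpose_mulVec, sqnorm_eq_dotProduct, ← smul_eq_mul, ← dotProduct_smul, ← h1]
    have h3 := sqnorm_pos hv
    have h4 := sqnorm_nonneg (Aᵀ *ᵥ v)
    have h5 : 0 < sqnorm (Aᵀ *ᵥ v) := h4.lt_of_ne' fun h0 => by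
      rw [h0, mul_zero] at h2
      exact h3.ne' h2
    have h6 := h v
    rw [h2] at h6
    refine ⟨?_, le_of_mul_le_mul_right h6 h5⟩
    by_contra! ht
    nlinarith
  exact ⟨Real.sSup_nonneg fun t ht => (key t ht).1, Real.sSup_le (fun t ht => (key t ht).2) hT⟩

lemma sqnorm_pinvRows_le (hT : 0 ≤ T) (h : ∀ v, sqnorm v ≤ T * sqnorm (Aᵀ *ᵥ v))
    (x : Fin d → ℝ) : sqnorm ((pinvRows A)ᵀ *ᵥ x) ≤ T * sqnorm x := by
  have hu := isUnit_det_of_sqnorm_le h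
  set y := (pinvRows A)ᵀ *ᵥ x with hy
  have h1 : (A * Aᵀ) *ᵥ y = A *ᵥ x := by
    rw [hy, pinvRows, transpose_mul, transpose_transpose, transpose_nonsing_inv, transpose_mul,
      transpose_transpose, mulVec_mulVec, ← Matrix.mul_assoc, mul_nonsing_inv _ hu, Matrix.one_mul]
  have h2 : sqnorm (Aᵀ *ᵥ y) = (Aᵀ *ᵥ y) ⬝ᵥ x := by
    rw [sqnorm_transpose_mulVec, h1, dotProduct_mulVec, ← mulVec_transpose]
  have h3 : 0 ≤ sqnorm (Aᵀ *ᵥ y - x) := sqnorm_nonneg _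
  have h4 : sqnorm (Aᵀ *ᵥ y - x)
      = sqnorm (Aᵀ *ᵥ y) - 2 * ((Aᵀ *ᵥ y) ⬝ᵥ x) + sqnorm x := by
    simp only [sqnorm_eq_dotProduct, sub_dotProduct, dotProduct_sub, dotProduct_comm x]
    ring
  refine (h y).trans (mul_le_mul_of_nonneg_left ?_ hT)
  linarith

end Deterministic

/-- `|t| ^ (-2/3)`, with value `∞` at `t = 0`. -/
def invRpow (t : ℝ) : ℝ≥0∞ := (ENNReal.ofReal (|t| ^ (2 / 3 : ℝ)))⁻¹

lemma measurable_invRpow : Measurable invRpow := by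
  unfold invRpow
  fun_prop

lemma lintegral_invRpow_gaussianReal_lt_top : ∫⁻ t, invRpow t ∂gaussianReal 0 1 < ⊤ := by
  have hbound : ∀ t, invRpow t ≤ 1 + (Set.Ioc (-1 : ℝ) 1).indicator invRpow t := by
    intro t
    by_cases ht : t ∈ Set.Ioc (-1 : ℝ) 1
    · rw [Set.indicator_of_mem ht]
      exact le_add_self
    · rw [Set.indicator_of_notMem ht, add_zero, invRpow, ENNReal.inv_le_one,
        ENNReal.one_le_ofReal]
      refine Real.one_le_rpow ?_ (by norm_num)
      by_contra! h
      exact ht ⟨(abs_lt.1 h).1, (abs_lt.1 h).2.le⟩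
  have hpdf : ∀ t, gaussianPDF 0 1 t ≤ 1 := by
    intro t
    rw [gaussianPDF, ENNReal.ofReal_le_one, gaussianPDFReal]
    have h1 : (√(2 * Real.pi * ((1 : ℝ≥0) : ℝ)))⁻¹ ≤ 1 := by
      apply inv_le_one_of_one_le₀
      rw [Real.one_le_sqrt]
      have := Real.pi_gt_three
      simp only [NNReal.coe_one]
      linarith
    have h2 : Real.exp (-(t - 0) ^ 2 / (2 * ((1 : ℝ≥0) : ℝ))) ≤ 1 := by
      rw [Real.exp_le_one_iff]
      simp only [NNReal.coe_one]
      nlinarith [sq_nonneg (t - 0)]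
    exact mul_le_one₀ h1 (Real.exp_nonneg _) h2
  have hvol : ∫⁻ t in Set.Ioc (-1 : ℝ) 1, invRpow t < ⊤ := by
    have hrpow : IntervalIntegrable (fun t : ℝ => |t| ^ (-(2 / 3) : ℝ)) volume (-1) 1 := by
      have h01 : IntervalIntegrable (fun t : ℝ => |t| ^ (-(2 / 3) : ℝ)) volume 0 1 := by
        refine (intervalIntegral.intervalIntegrable_rpow' (r := -(2 / 3)) (by norm_num)).congr
          fun t ht => ?_
        rw [Set.uIoc_of_le zero_le_one] at ht
        simp only [abs_of_pos ht.1]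
      refine IntervalIntegrable.trans (b := 0) ?_ h01
      simpa using ((IntervalIntegrable.iff_comp_neg (by simp)).1 h01).symm
    rw [intervalIntegrable_iff_integrableOn_Ioc_of_le (by norm_num)] at hrpow
    refine lt_of_le_of_lt (lintegral_mono_ae ?_) hrpow.lintegral_lt_top
    refine ae_restrict_of_ae ?_
    filter_upwards [Measure.ae_ne volume (0 : ℝ)] with t ht
    rw [invRpow, ← ENNReal.ofReal_inv_of_pos (Real.rpow_pos_of_pos (abs_pos.2 ht) _),
      Real.rpow_neg (abs_nonneg _)]
  calc ∫⁻ t, invRpow t ∂gaussianReal 0 1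
      ≤ ∫⁻ t, (1 + (Set.Ioc (-1 : ℝ) 1).indicator invRpow t) ∂gaussianReal 0 1 :=
        lintegral_mono hbound
    _ = 1 + ∫⁻ t in Set.Ioc (-1 : ℝ) 1, invRpow t ∂gaussianReal 0 1 := by
        rw [lintegral_add_left measurable_const, lintegral_indicator measurableSet_Ioc]
        simp
    _ ≤ 1 + ∫⁻ t in Set.Ioc (-1 : ℝ) 1, invRpow t := by
        gcongr
        rw [gaussianReal_of_var_ne_zero _ one_ne_zero]
        refine Measure.le_iff.2 fun s hs => ?_
        rw [withDensity_apply _ hs]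
        calc ∫⁻ a in s, gaussianPDF 0 1 a ≤ ∫⁻ _ in s, 1 := lintegral_mono hpdf
          _ = volume s := by simp
    _ < ⊤ := ENNReal.add_lt_top.2 ⟨ENNReal.one_lt_top, hvol⟩

/-- Orthonormal linear combinations of independent standard Gaussians are again independent
standard Gaussians, so the expectation of the product of their `invRpow` factorizes. -/
lemma lintegral_prod_invRpow_orthonormal {Ω : Type*} {mΩ : MeasurableSpace Ω} {P : Measure Ω}
    [IsProbabilityMeasure P] {N r : ℕ} {X : Fin N → Ω → ℝ} (hXm : ∀ k, Measurable (X k))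
    (hX : ∀ k, P.map (X k) = gaussianReal 0 1) (hind : iIndepFun X P)
    {u : Fin r → EuclideanSpace ℝ (Fin N)} (hu : Orthonormal ℝ u) :
    ∫⁻ ω, ∏ l, invRpow (∑ k, u l k * X k ω) ∂P
      = (∫⁻ t, invRpow t ∂gaussianReal 0 1) ^ r := by
  have hG : ∀ k, HasGaussianLaw (X k) P := fun k => ⟨by rw [hX k]; infer_instance⟩
  have hmem : ∀ k, MemLp (X k) 2 P := fun k => (hG k).memLp_two
  have hmean : ∀ k, ∫ ω, X k ω ∂P = 0 := by
    intro k
    have := integral_map (μ := P) (hXm k).aemeasurable (f := fun x : ℝ => x)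
      (by fun_prop)
    rw [← this, hX k]
    exact integral_id_gaussianReal
  have hcovX : ∀ i j, cov[X i, X j; P] = if i = j then 1 else 0 := by
    intro i j
    split_ifs with hij
    · subst hij
      rw [covariance_self (hXm i).aemeasurable]
      have := variance_map (μ := P) (X := fun x : ℝ => x) (Y := X i)
        (by fun_prop) (hXm i).aemeasurable
      rw [hX i, variance_fun_id_gaussianReal] at this
      simpa [Function.comp_def] using this.symm
    · exact (hind.indepFun hij).covariance_eq_zero (hmem i) (hmem j)
  set S : Fin r → Ω → ℝ := fun l ω => ∑ k, u l k * X k ω with hS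
  have hSm : ∀ l, Measurable (S l) := fun l => by simp only [hS]; fun_prop
  have hjoint : HasGaussianLaw (fun ω l => S l ω) P := by
    let L : (Fin N → ℝ) →L[ℝ] (Fin r → ℝ) :=
      LinearMap.toContinuousLinearMap (Matrix.mulVecLin (Matrix.of fun l k => u l k))
    exact (hind.hasGaussianLaw hG).map_fun L
  have hcov : ∀ l l', cov[S l, S l'; P] = if l = l' then 1 else 0 := by
    intro l l'
    simp only [hS]
    rw [covariance_fun_sum_fun_sum (fun i => (hmem i).const_mul _)
      (fun i => (hmem i).const_mul _)]
    simp only [covariance_const_mul_left, covariance_const_mul_right, hcovX]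
    have := orthonormal_iff_ite.1 hu l l'
    rw [PiLp.inner_apply] at this
    simpa [mul_comm] using this
  have hSind : iIndepFun S P :=
    hjoint.iIndepFun_of_covariance_eq_zero fun i j hij => by rw [hcov, if_neg hij]
  have hSmap : ∀ l, P.map (S l) = gaussianReal 0 1 := by
    intro l
    rw [(hjoint.eval l).map_eq_gaussianReal, ← covariance_self (hSm l).aemeasurable, hcov]
    have : ∫ ω, S l ω ∂P = 0 := by
      simp only [hS]
      rw [integral_finsetSum _ fun k _ => ((hG k).integrable).const_mul _]
      simp [integral_const_mul, hmean]
    rw [this]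
    simp
  rw [lintegral_prod_eq_prod_lintegral_of_indepFun Finset.univ (fun l ω => invRpow (S l ω))
    (hSind.comp (fun _ => invRpow) fun _ => measurable_invRpow)
    fun l => measurable_invRpow.comp (hSm l)]
  rw [Finset.prod_congr rfl fun l _ => by
    rw [← lintegral_map measurable_invRpow (hSm l), hSmap l]]
  simp

section RowGap

variable {m N : ℕ}

/-- Squared distance from `b` to the span of the rows of `R`. -/
def rowGap (b : Fin N → ℝ) (R : Fin m → Fin N → ℝ) : ℝ≥0∞ :=
  ⨅ c : Fin m → ℝ, ENNReal.ofReal (sqnorm fun k => b k - ∑ j, c j * R j k)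

lemma measurable_rowGap :
    Measurable fun p : (Fin N → ℝ) × (Fin m → Fin N → ℝ) => rowGap p.1 p.2 := by
  refine UpperSemicontinuous.measurable (upperSemicontinuous_iInf fun c => ?_)
  refine Continuous.upperSemicontinuous (ENNReal.continuous_ofReal.comp ?_)
  unfold sqnorm
  fun_prop

lemma exists_orthonormal_orthogonal {r : ℕ} (hN : m + r ≤ N) (R : Fin m → Fin N → ℝ) :
    ∃ u : Fin r → EuclideanSpace ℝ (Fin N), Orthonormal ℝ u ∧
      ∀ l j, ∑ k, u l k * R j k = 0 := by
  set w : Fin m → EuclideanSpace ℝ (Fin N) := fun j => WithLp.toLp 2 (R j)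
  set K := Submodule.span ℝ (Set.range w)
  have hK : Module.finrank ℝ K ≤ m := by
    simpa [Set.finrank] using! finrank_range_le_card (R := ℝ) w
  have hsum := K.finrank_add_finrank_orthogonal
  rw [finrank_euclideanSpace_fin] at hsum
  have hr : r ≤ Module.finrank ℝ Kᗮ := by omega
  refine ⟨fun l => (stdOrthonormalBasis ℝ Kᗮ (Fin.castLE hr l) : Kᗮ), ?_, fun l j => ?_⟩
  · exact ((stdOrthonormalBasis ℝ Kᗮ).orthonormal.comp _
      (Fin.castLE_injective hr)).comp_linearIsometry Kᗮ.subtypeₗᵢ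
  · have := (Submodule.mem_orthogonal K _).1 (stdOrthonormalBasis ℝ Kᗮ (Fin.castLE hr l)).2 (w j)
      (Submodule.subset_span ⟨j, rfl⟩)
    rw [PiLp.inner_apply] at this
    simpa [w] using this

lemma ofReal_sq_le_rowGap {b : Fin N → ℝ} {R : Fin m → Fin N → ℝ} {u : EuclideanSpace ℝ (Fin N)}
    (hu : ‖u‖ = 1) (huR : ∀ j, ∑ k, u k * R j k = 0) :
    ENNReal.ofReal ((∑ k, u k * b k) ^ 2) ≤ rowGap b R := by
  refine le_iInf fun c => ENNReal.ofReal_le_ofReal ?_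
  have h1 : ∑ k, u k * b k = ∑ k, u k * (b k - ∑ j, c j * R j k) := by
    simp only [mul_sub, Finset.sum_sub_distrib, Finset.mul_sum]
    rw [Finset.sum_comm]
    have : ∀ j, ∑ k, u k * (c j * R j k) = 0 := fun j => by
      rw [← mul_zero (c j), ← huR j, Finset.mul_sum]
      exact Finset.sum_congr rfl fun k _ => by ring
    simp [this]
  have h2 : ∑ k, u k ^ 2 = 1 := by
    rw [← EuclideanSpace.real_norm_sq_eq, hu, one_pow]
  rw [h1]
  refine (Finset.sum_mul_sq_le_sq_mul_sq _ _ _).trans ?_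
  rw [h2, one_mul, sqnorm]

lemma invRpow_ge_of_sq_le {s : ℝ} {g : ℝ≥0∞} (h : ENNReal.ofReal (s ^ 2) ≤ g) :
    (g ^ (1 / 3 : ℝ))⁻¹ ≤ invRpow s := by
  rw [invRpow, ENNReal.inv_le_inv]
  calc ENNReal.ofReal (|s| ^ (2 / 3 : ℝ)) = ENNReal.ofReal (s ^ 2) ^ (1 / 3 : ℝ) := by
        rw [ENNReal.ofReal_rpow_of_nonneg (sq_nonneg s) (by norm_num), ← sq_abs,
          ← Real.rpow_natCast, ← Real.rpow_mul (abs_nonneg s)]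
        norm_num
    _ ≤ g ^ (1 / 3 : ℝ) := ENNReal.rpow_le_rpow h (by norm_num)

lemma inv_rowGap_pow_three_le {b : Fin N → ℝ} {R : Fin m → Fin N → ℝ}
    {u : Fin 9 → EuclideanSpace ℝ (Fin N)} (hu : Orthonormal ℝ u)
    (huR : ∀ l j, ∑ k, u l k * R j k = 0) :
    (rowGap b R)⁻¹ ^ 3 ≤ ∏ l, invRpow (∑ k, u l k * b k) := by
  calc (rowGap b R)⁻¹ ^ 3 = ∏ _l : Fin 9, (rowGap b R ^ (1 / 3 : ℝ))⁻¹ := by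
        rw [Finset.prod_const, Finset.card_univ, Fintype.card_fin, ← ENNReal.inv_pow,
          ← ENNReal.inv_pow, ← ENNReal.rpow_mul_natCast]
        norm_num
    _ ≤ _ := Finset.prod_le_prod' fun l _ =>
        invRpow_ge_of_sq_le (ofReal_sq_le_rowGap (hu.norm_eq_one l) (huR l))

end RowGap

section Rows

variable {m N d : ℕ} (hNd : N ≤ d)

/-- Squared distance from the `i`-th row to the span of the other rows, after truncating
all rows to their first `N` coordinates. -/
def truncRowGap (A : Fin (m + 1) → Fin d → ℝ) (i : Fin (m + 1)) : ℝ≥0∞ :=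
  rowGap (fun k : Fin N => A i (Fin.castLE hNd k))
    fun j k => A (i.succAbove j) (Fin.castLE hNd k)

lemma measurable_truncRowGap (i : Fin (m + 1)) :
    Measurable fun A : Fin (m + 1) → Fin d → ℝ => truncRowGap hNd A i :=
  measurable_rowGap.comp (f := fun A : Fin (m + 1) → Fin d → ℝ =>
    (fun k : Fin N => A i (Fin.castLE hNd k),
      fun j k => A (i.succAbove j) (Fin.castLE hNd k))) (by fun_prop)

lemma lintegral_inv_truncRowGap_pow_three_lt_top {κ : Fin d → Measure ℝ}
    [∀ j, IsProbabilityMeasure (κ j)] (hN : m + 9 ≤ N)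
    (hκ : ∀ k : Fin N, κ (Fin.castLE hNd k) = gaussianReal 0 1) (i : Fin (m + 1)) :
    ∫⁻ A, (truncRowGap hNd A i)⁻¹ ^ 3 ∂(Measure.pi fun _ => Measure.pi κ) < ⊤ := by
  set f : (Fin d → ℝ) × (Fin m → Fin d → ℝ) → ℝ≥0∞ := fun p =>
    (rowGap (fun k : Fin N => p.1 (Fin.castLE hNd k)) fun j k => p.2 j (Fin.castLE hNd k))⁻¹ ^ 3
  have hf : Measurable f := by
    refine Measurable.pow_const (Measurable.inv ?_) 3
    exact measurable_rowGap.comp (f := fun p : (Fin d → ℝ) × (Fin m → Fin d → ℝ) =>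
      (fun k : Fin N => p.1 (Fin.castLE hNd k), fun j k => p.2 j (Fin.castLE hNd k)))
      (by fun_prop)
  have hswap : ∫⁻ A, (truncRowGap hNd A i)⁻¹ ^ 3 ∂(Measure.pi fun _ => Measure.pi κ)
      = ∫⁻ p, f p ∂(Measure.pi κ).prod (Measure.pi fun _ : Fin m => Measure.pi κ) :=
    (measurePreserving_piFinSuccAbove (fun _ : Fin (m + 1) => Measure.pi κ) i).lintegral_comp hf
  rw [hswap, lintegral_prod_symm _ hf.aemeasurable]
  have hind : iIndepFun (fun (k : Fin N) (b : Fin d → ℝ) => b (Fin.castLE hNd k))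
      (Measure.pi κ) :=
    (iIndepFun_pi (μ := κ) (X := fun _ x => x) fun _ => by fun_prop).precomp
      (Fin.castLE_injective hNd)
  have hmap : ∀ k : Fin N, (Measure.pi κ).map (fun b : Fin d → ℝ => b (Fin.castLE hNd k))
      = gaussianReal 0 1 := fun k => by
    rw [← hκ k]
    exact (measurePreserving_eval κ (Fin.castLE hNd k)).map_eq
  calc ∫⁻ R, ∫⁻ b, f (b, R) ∂Measure.pi κ ∂(Measure.pi fun _ : Fin m => Measure.pi κ)
      ≤ ∫⁻ _R : Fin m → Fin d → ℝ, (∫⁻ t, invRpow t ∂gaussianReal 0 1) ^ 9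
          ∂(Measure.pi fun _ : Fin m => Measure.pi κ) := by
        refine lintegral_mono fun R => ?_
        obtain ⟨u, hu, huR⟩ := exists_orthonormal_orthogonal hN
          fun j (k : Fin N) => R j (Fin.castLE hNd k)
        rw [← lintegral_prod_invRpow_orthonormal (by fun_prop) hmap hind hu]
        exact lintegral_mono fun b => inv_rowGap_pow_three_le hu huR
    _ < ⊤ := by
        rw [lintegral_const, measure_univ, mul_one]
        exact ENNReal.pow_lt_top lintegral_invRpow_gaussianReal_lt_top

lemma ofReal_sq_mul_truncRowGap_le (A : Fin (m + 1) → Fin d → ℝ) (v : Fin (m + 1) → ℝ)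
    (i : Fin (m + 1)) :
    ENNReal.ofReal (v i ^ 2) * truncRowGap hNd A i
      ≤ ENNReal.ofReal (sqnorm ((Matrix.of A)ᵀ *ᵥ v)) := by
  rcases eq_or_ne (v i) 0 with hv | hv
  · simp [hv]
  have hgap : truncRowGap hNd A i ≤ _ := iInf_le _ fun j => -(v (i.succAbove j) / v i)
  refine (mul_le_mul_right hgap _).trans ?_
  rw [← ENNReal.ofReal_mul (sq_nonneg _)]
  refine ENNReal.ofReal_le_ofReal ?_
  have hsub : ∑ k : Fin N, ((Matrix.of A)ᵀ *ᵥ v) (Fin.castLE hNd k) ^ 2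
      ≤ sqnorm ((Matrix.of A)ᵀ *ᵥ v) := by
    exact (Finset.sum_map Finset.univ (Fin.castLEEmb hNd)
      fun k => ((Matrix.of A)ᵀ *ᵥ v) k ^ 2).symm.trans_le
        (Finset.sum_le_univ_sum_of_nonneg fun _ => sq_nonneg _)
  refine le_trans (le_of_eq ?_) hsub
  rw [sqnorm, Finset.mul_sum]
  refine Finset.sum_congr rfl fun k _ => ?_
  rw [← mul_pow]
  congr 1
  simp only [mulVec, dotProduct, transpose_apply, of_apply]
  rw [Fin.sum_univ_succAbove _ i, mul_sub, Finset.mul_sum, sub_eq_add_neg,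
    ← Finset.sum_neg_distrib]
  congr 1
  · ring
  · refine Finset.sum_congr rfl fun j _ => ?_
    field_simp

lemma sqnorm_le_sum_inv_truncRowGap {A : Fin (m + 1) → Fin d → ℝ}
    (hA : ∑ i, (truncRowGap hNd A i)⁻¹ ≠ ⊤) (v : Fin (m + 1) → ℝ) :
    sqnorm v ≤ (∑ i, (truncRowGap hNd A i)⁻¹).toReal * sqnorm ((Matrix.of A)ᵀ *ᵥ v) := by
  have key : ENNReal.ofReal (sqnorm v)
      ≤ (∑ i, (truncRowGap hNd A i)⁻¹) * ENNReal.ofReal (sqnorm ((Matrix.of A)ᵀ *ᵥ v)) := by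
    rw [sqnorm, ENNReal.ofReal_sum_of_nonneg fun _ _ => sq_nonneg _, Finset.sum_mul]
    refine Finset.sum_le_sum fun i _ => ?_
    have hi : truncRowGap hNd A i ≠ 0 := by
      rw [← ENNReal.inv_ne_top]
      exact (ENNReal.sum_ne_top.1 hA) i (Finset.mem_univ i)
    rw [mul_comm, ← div_eq_mul_inv,
      ENNReal.le_div_iff_mul_le (Or.inl hi) (Or.inr ENNReal.ofReal_ne_top)]
    exact ofReal_sq_mul_truncRowGap_le hNd A v i
  rw [← ENNReal.ofReal_toReal hA, ← ENNReal.ofReal_mul ENNReal.toReal_nonneg] at key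
  exact (ENNReal.ofReal_le_ofReal_iff
    (mul_nonneg ENNReal.toReal_nonneg (sqnorm_nonneg _))).1 key

end Rows

lemma sum_pow_three_le {ι : Type*} (s : Finset ι) (a : ι → ℝ≥0∞) :
    (∑ i ∈ s, a i) ^ 3 ≤ (s.card : ℝ≥0∞) ^ 3 * ∑ i ∈ s, a i ^ 3 := by
  rcases s.eq_empty_or_nonempty with rfl | hs
  · simp
  obtain ⟨i, hi, hmax⟩ := s.exists_max_image a hs
  calc (∑ j ∈ s, a j) ^ 3 ≤ (s.card • a i) ^ 3 := by
        gcongr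
        exact Finset.sum_le_card_nsmul _ _ _ hmax
    _ = (s.card : ℝ≥0∞) ^ 3 * a i ^ 3 := by rw [nsmul_eq_mul, mul_pow]
    _ ≤ _ := by
        gcongr
        exact Finset.single_le_sum (f := fun j => a j ^ 3) (fun _ _ => zero_le) hi

lemma one_add_pow_three_le (a : ℝ≥0∞) : (1 + a) ^ 3 ≤ 8 * (1 + a ^ 3) := by
  have h := sum_pow_three_le Finset.univ ![1, a]
  simpa [show (2 : ℝ≥0∞) ^ 3 = 8 by norm_num] using h

lemma lintegral_sq_gaussianReal_lt_top (m : ℝ) (v : ℝ≥0) :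
    ∫⁻ t, ENNReal.ofReal (t ^ 2) ∂gaussianReal m v < ⊤ :=
  ((memLp_id_gaussianReal (μ := m) (v := v) 2).integrable_sq).lintegral_lt_top

lemma lintegral_sq_gmix_lt_top (σ m : ℝ) : ∫⁻ t, ENNReal.ofReal (t ^ 2) ∂gmix σ m < ⊤ := by
  simp only [gmix, lintegral_add_measure, lintegral_smul_measure, smul_eq_mul]
  have h3 : (3 : ℝ≥0∞)⁻¹ < ⊤ := by simp
  have h := fun x => ENNReal.mul_lt_top h3
    (lintegral_sq_gaussianReal_lt_top x (σ ^ 2).toNNReal)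
  exact ENNReal.add_lt_top.2 ⟨ENNReal.add_lt_top.2 ⟨h _, h _⟩, h _⟩

lemma lintegral_sqnorm_lt_top {d : ℕ} {κ : Fin d → Measure ℝ} [∀ j, IsProbabilityMeasure (κ j)]
    (hκ : ∀ j, ∫⁻ t, ENNReal.ofReal (t ^ 2) ∂κ j < ⊤) :
    ∫⁻ x, ENNReal.ofReal (sqnorm x) ∂Measure.pi κ < ⊤ := by
  simp only [sqnorm]
  simp_rw [ENNReal.ofReal_sum_of_nonneg fun _ _ => sq_nonneg _]
  rw [lintegral_finsetSum _ fun j _ => by fun_prop]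
  refine ENNReal.sum_lt_top.2 fun j _ => ?_
  have := (measurePreserving_eval κ j).lintegral_comp
    (f := fun t : ℝ => ENNReal.ofReal (t ^ 2)) (by fun_prop)
  simp only [Function.eval] at this
  rw [this]
  exact hκ j

/-- A quantity dominated by `(1 + τ)³ (1 + ‖x‖²)`, where `τ` is the sum of the inverse squared
row distances, has finite expectation. -/
lemma lintegral_lt_top_of_le {m N d : ℕ} (hNd : N ≤ d) (hN : m + 9 ≤ N) {κ : Fin d → Measure ℝ}
    [∀ j, IsProbabilityMeasure (κ j)]
    (hg : ∀ k : Fin N, κ (Fin.castLE hNd k) = gaussianReal 0 1)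
    (hκ : ∀ j, ∫⁻ t, ENNReal.ofReal (t ^ 2) ∂κ j < ⊤)
    {F : (Fin (m + 1) → Fin d → ℝ) × (Fin d → ℝ) → ℝ}
    (hF : ∀ A x, ∀ τ : ℝ, 0 ≤ τ →
      (∀ v, sqnorm v ≤ τ * sqnorm ((Matrix.of A)ᵀ *ᵥ v)) →
      F (A, x) ≤ (1 + τ) ^ 3 * (1 + sqnorm x)) :
    ∫⁻ p, ENNReal.ofReal (F p)
      ∂(Measure.pi fun _ : Fin (m + 1) => Measure.pi κ).prod (Measure.pi κ) < ⊤ := by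
  set τ : (Fin (m + 1) → Fin d → ℝ) → ℝ≥0∞ := fun A => ∑ i, (truncRowGap hNd A i)⁻¹
  have hgm : ∀ i : Fin (m + 1), Measurable fun A : Fin (m + 1) → Fin d → ℝ =>
      (truncRowGap hNd A i)⁻¹ ^ 3 :=
    fun i => (measurable_truncRowGap hNd i).inv.pow_const 3
  set B : (Fin (m + 1) → Fin d → ℝ) → ℝ≥0∞ := fun A =>
    8 * (1 + ((m + 1 : ℕ) : ℝ≥0∞) ^ 3 * ∑ i, (truncRowGap hNd A i)⁻¹ ^ 3)
  have hB : Measurable B := by fun_prop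
  have hτB : ∀ A, (1 + τ A) ^ 3 ≤ B A := fun A => by
    refine (one_add_pow_three_le _).trans (mul_le_mul_right (add_le_add_right ?_ _) _)
    simpa using sum_pow_three_le Finset.univ fun i => (truncRowGap hNd A i)⁻¹
  have hle : ∀ p : (Fin (m + 1) → Fin d → ℝ) × (Fin d → ℝ),
      ENNReal.ofReal (F p) ≤ B p.1 * (1 + ENNReal.ofReal (sqnorm p.2)) := by
    rintro ⟨A, x⟩
    refine le_trans ?_ (mul_le_mul_left (hτB A) _)
    rcases eq_or_ne (τ A) ⊤ with hA | hA
    · simp [hA]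
    · have h := ENNReal.ofReal_le_ofReal (hF A x (τ A).toReal ENNReal.toReal_nonneg
        (sqnorm_le_sum_inv_truncRowGap hNd hA))
      refine h.trans (le_of_eq ?_)
      have h0 : 0 ≤ (τ A).toReal := ENNReal.toReal_nonneg
      rw [ENNReal.ofReal_mul (by positivity), ENNReal.ofReal_pow (by positivity),
        ENNReal.ofReal_add zero_le_one h0, ENNReal.ofReal_add zero_le_one (sqnorm_nonneg x),
        ENNReal.ofReal_toReal hA, ENNReal.ofReal_one]
  refine (lintegral_mono hle).trans_lt ?_
  have hsq : Measurable fun x : Fin d → ℝ => 1 + ENNReal.ofReal (sqnorm x) := by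
    unfold sqnorm
    fun_prop
  rw [lintegral_prod_mul hB.aemeasurable hsq.aemeasurable]
  refine ENNReal.mul_lt_top ?_ ?_
  · rw [lintegral_const_mul _ (by fun_prop), lintegral_add_left measurable_const,
      lintegral_const_mul _ (by fun_prop), lintegral_finsetSum _ fun i _ => hgm i]
    simp only [lintegral_const, measure_univ, mul_one]
    refine ENNReal.mul_lt_top (by simp) (ENNReal.add_lt_top.2 ⟨ENNReal.one_lt_top, ?_⟩)
    exact ENNReal.mul_lt_top (ENNReal.pow_lt_top (ENNReal.natCast_lt_top _))
      (ENNReal.sum_lt_top.2 fun i _ =>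
        lintegral_inv_truncRowGap_pow_three_lt_top hNd hN hg i)
  · rw [lintegral_add_left measurable_const, lintegral_const, measure_univ, mul_one]
    exact ENNReal.add_lt_top.2 ⟨ENNReal.one_lt_top, lintegral_sqnorm_lt_top hκ⟩

/-- Lemma 6 of the paper: finiteness of the moment quantities in the
overparametrized regime.  The sample `p = (rows of A, x)` consists of the `n` rows of the
design matrix `A` and the test point `x`, i.i.d. from the marginal `𝒟₁ × ⋯ × 𝒟_d` of a
product distribution whose first `n+8` coordinates are standard Gaussian and whose
remaining coordinates are Gaussian or trimodal Gaussian mixtures. -/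
theorem stmt13 (n d D : ℕ) (hn : 1 ≤ n) (hd : n + 8 ≤ d) (hdD : d ≤ D)
    (ν : Fin D → Measure ℝ) [∀ k, IsProbabilityMeasure (ν k)]
    (hgauss : ∀ k : Fin D, (k : ℕ) < n + 8 → ν k = gaussianReal 0 1)
    (htail : ∀ k : Fin D, n + 8 ≤ (k : ℕ) →
      (∃ σ : ℝ, 0 < σ ∧ ν k = gaussianReal 0 (σ ^ 2).toNNReal) ∨
      (∃ σ m : ℝ, 0 < σ ∧ ν k = gmix σ m)) :
    (∫⁻ p : (Fin n → Fin d → ℝ) × (Fin d → ℝ),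
        ENNReal.ofReal (sqnorm ((pinvRows (Matrix.of p.1))ᵀ *ᵥ p.2))
        ∂(Measure.pi fun _ : Fin n => Measure.pi fun j : Fin d => ν (Fin.castLE hdD j)).prod
          (Measure.pi fun j : Fin d => ν (Fin.castLE hdD j))) < ⊤ ∧
    (∫⁻ p : (Fin n → Fin d → ℝ) × (Fin d → ℝ),
        ENNReal.ofReal (lambdaMax ((Matrix.of p.1 * (Matrix.of p.1)ᵀ)⁻¹) ^ 2)
        ∂(Measure.pi fun _ : Fin n => Measure.pi fun j : Fin d => ν (Fin.castLE hdD j)).prod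
          (Measure.pi fun j : Fin d => ν (Fin.castLE hdD j))) < ⊤ ∧
    (∫⁻ p : (Fin n → Fin d → ℝ) × (Fin d → ℝ),
        ENNReal.ofReal (lambdaMax ((Matrix.of p.1 * (Matrix.of p.1)ᵀ)⁻¹)
          * sqnorm ((pinvRows (Matrix.of p.1))ᵀ *ᵥ p.2))
        ∂(Measure.pi fun _ : Fin n => Measure.pi fun j : Fin d => ν (Fin.castLE hdD j)).prod
          (Measure.pi fun j : Fin d => ν (Fin.castLE hdD j))) < ⊤ ∧
    (∫⁻ p : (Fin n → Fin d → ℝ) × (Fin d → ℝ),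
        ENNReal.ofReal (lambdaMax ((Matrix.of p.1 * (Matrix.of p.1)ᵀ)⁻¹) ^ 2
          * sqnorm ((pinvRows (Matrix.of p.1))ᵀ *ᵥ p.2))
        ∂(Measure.pi fun _ : Fin n => Measure.pi fun j : Fin d => ν (Fin.castLE hdD j)).prod
          (Measure.pi fun j : Fin d => ν (Fin.castLE hdD j))) < ⊤ := by
  have hsq : ∀ j : Fin d, ∫⁻ t, ENNReal.ofReal (t ^ 2) ∂ν (Fin.castLE hdD j) < ⊤ := by
    intro j
    rcases lt_or_ge ((Fin.castLE hdD j : Fin D) : ℕ) (n + 8) with hj | hj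
    · rw [hgauss _ hj]
      exact lintegral_sq_gaussianReal_lt_top _ _
    · rcases htail _ hj with ⟨σ, _, h⟩ | ⟨σ, m, _, h⟩ <;> rw [h]
      · exact lintegral_sq_gaussianReal_lt_top _ _
      · exact lintegral_sq_gmix_lt_top _ _
  have hg : ∀ k : Fin (n + 8), ν (Fin.castLE hdD (Fin.castLE hd k)) = gaussianReal 0 1 :=
    fun k => hgauss _ (by simp)
  obtain ⟨m, rfl⟩ := Nat.exists_eq_add_of_le' hn
  refine ⟨lintegral_lt_top_of_le hd (by omega) hg hsq fun A x τ hτ h => ?_,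
    lintegral_lt_top_of_le hd (by omega) hg hsq fun A x τ hτ h => ?_,
    lintegral_lt_top_of_le hd (by omega) hg hsq fun A x τ hτ h => ?_,
    lintegral_lt_top_of_le hd (by omega) hg hsq fun A x τ hτ h => ?_⟩
  all_goals
    have hs := sqnorm_pinvRows_le hτ h x
    have hs0 := sqnorm_nonneg ((pinvRows (Matrix.of A))ᵀ *ᵥ x)
    have hx := sqnorm_nonneg x
    obtain ⟨hl0, hl⟩ := lambdaMax_nonneg_and_le hτ h
    have hτ1 : τ ≤ 1 + τ := by linarith
    have h1 : 1 ≤ 1 + τ := by linarith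
  · calc _ ≤ (1 + τ) ^ 1 * (1 + sqnorm x) := by rw [pow_one]; nlinarith
      _ ≤ _ := by gcongr; norm_num
  · calc _ ≤ τ ^ 2 * 1 := by rw [mul_one]; gcongr
      _ ≤ (1 + τ) ^ 2 * (1 + sqnorm x) := by gcongr; linarith
      _ ≤ _ := by gcongr; norm_num
  · calc _ ≤ τ * (τ * sqnorm x) := by gcongr
      _ = τ ^ 2 * sqnorm x := by ring
      _ ≤ (1 + τ) ^ 2 * (1 + sqnorm x) := by gcongr; linarith
      _ ≤ _ := by gcongr; norm_num
  · calc _ ≤ τ ^ 2 * (τ * sqnorm x) := by gcongr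
      _ = τ ^ 3 * sqnorm x := by ring
      _ ≤ _ := by gcongr; linarith

end
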